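/- Let r > s > 0 be integers, let V be an r-dimensional vector space over the field F₂ with two elements, and let α ∈ GL(V) with α ≠ 1. Then the number of subspaces W of V of codimension s with α(W) = W is at most C(r−1, s−1)₂ + C(r−2, s)₂ · 2^s, where C(a,b)₂ denotes the Gaussian binomial coefficient (taken to be 0 if b > a or b < 0). -/

import Mathlib

open Finset

/-- The Gaussian binomial coefficient `C(r,s)₂ = ∏_{i=0}^{s−1} (2^{r−i} − 1)/(2^{s−i} − 1)`,
as a real number.  (When `s > r` some factor vanishes, so the value is `0`, matching the
convention `C(a,b)₂ = 0` for `b > a`.) -/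
noncomputable def gaussBinom (r s : ℕ) : ℝ :=
  ∏ i ∈ Finset.range s, (((2 : ℝ) ^ (r - i) - 1) / ((2 : ℝ) ^ (s - i) - 1))

theorem two_pow_succ_sub_one_pos (n : ℕ) : (0 : ℝ) < 2 ^ (n + 1) - 1 :=
  sub_pos.2 (one_lt_pow₀ one_lt_two n.succ_ne_zero)

theorem gaussBinom_self (s : ℕ) : gaussBinom s s = 1 := by
  refine Finset.prod_eq_one fun i hi => div_self ?_
  obtain ⟨k, hk⟩ := Nat.exists_eq_add_of_lt (Finset.mem_range.1 hi)
  rw [show s - i = k + 1 by omega]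
  exact (two_pow_succ_sub_one_pos k).ne'

theorem gaussBinom_eq_zero_of_lt {n s : ℕ} (h : n < s) : gaussBinom n s = 0 :=
  Finset.prod_eq_zero (Finset.mem_range.2 h) (by simp)

theorem gaussBinom_eq_div (n s : ℕ) :
    gaussBinom n s = (∏ i ∈ Finset.range s, ((2 : ℝ) ^ (n - i) - 1)) /
      ∏ i ∈ Finset.range s, ((2 : ℝ) ^ (i + 1) - 1) := by
  rw [gaussBinom, Finset.prod_div_distrib,
    ← Finset.prod_range_reflect (fun i => (2 : ℝ) ^ (i + 1) - 1)]
  congr 1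
  refine Finset.prod_congr rfl fun i hi => ?_
  rw [show s - 1 - i + 1 = s - i by have := Finset.mem_range.1 hi; omega]

theorem gaussBinom_succ_right_mul (n s : ℕ) :
    gaussBinom n (s + 1) * (2 ^ (s + 1) - 1) = (2 ^ (n - s) - 1) * gaussBinom n s := by
  have h := (two_pow_succ_sub_one_pos s).ne'
  rw [gaussBinom_eq_div, gaussBinom_eq_div, Finset.prod_range_succ, Finset.prod_range_succ]
  field_simp

theorem gaussBinom_succ_succ_mul (n s : ℕ) :
    gaussBinom (n + 1) (s + 1) * (2 ^ (s + 1) - 1) = (2 ^ (n + 1) - 1) * gaussBinom n s := by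
  have h := (two_pow_succ_sub_one_pos s).ne'
  rw [gaussBinom_eq_div, gaussBinom_eq_div, Finset.prod_range_succ', Finset.prod_range_succ]
  simp only [Nat.add_sub_add_right, Nat.sub_zero]
  field_simp

theorem gaussBinom_succ_left_mul (n s : ℕ) :
    gaussBinom (n + 1) s * (2 ^ (n + 1 - s) - 1) = (2 ^ (n + 1) - 1) * gaussBinom n s := by
  linarith [gaussBinom_succ_right_mul (n + 1) s, gaussBinom_succ_succ_mul n s]

/-- The `q`-Pascal rule at `q = 2`. -/
theorem gaussBinom_succ_succ {n s : ℕ} (h : s ≤ n) :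
    gaussBinom (n + 1) (s + 1) = gaussBinom n s + 2 ^ (s + 1) * gaussBinom n (s + 1) := by
  refine mul_right_cancel₀ (two_pow_succ_sub_one_pos s).ne' ?_
  have h2 : (2 : ℝ) ^ (n + 1) = 2 ^ (s + 1) * 2 ^ (n - s) := by
    rw [← pow_add]; congr 1; omega
  rw [gaussBinom_succ_succ_mul, add_mul, mul_assoc, gaussBinom_succ_right_mul, h2]
  ring

section SubspaceCount

variable {V : Type*} [AddCommGroup V] [Module (ZMod 2) V]

open Module Submodule

/-- By the correspondence theorem, the subspaces of codimension `s` containing `P` are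
counted in the quotient by `P`. -/
theorem card_codim_subspaces_ge_eq_card_quotient (P : Submodule (ZMod 2) V) (s : ℕ) :
    Nat.card {W : Submodule (ZMod 2) V // finrank (ZMod 2) (V ⧸ W) = s ∧ P ≤ W} =
      Nat.card {W : Submodule (ZMod 2) (V ⧸ P) // finrank (ZMod 2) ((V ⧸ P) ⧸ W) = s} := by
  refine Nat.card_congr
    { toFun := fun W => ⟨W.1.map P.mkQ, ?_⟩
      invFun := fun W => ⟨W.1.comap P.mkQ, ?_, le_comap_mkQ P _⟩
      left_inv := fun W => Subtype.ext ?_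
      right_inv := fun W => Subtype.ext ?_ }
  · rw [(quotientQuotientEquivQuotient P W.1 W.2.2).finrank_eq, W.2.1]
  · rw [← (quotientQuotientEquivQuotient P _ (le_comap_mkQ P W.1)).finrank_eq,
      map_comap_eq_of_surjective P.mkQ_surjective, W.2]
  · simpa [comap_map_mkQ] using W.2.2
  · exact map_comap_eq_of_surjective P.mkQ_surjective _

theorem card_filter_codim_subspaces_ge [Fintype (Submodule (ZMod 2) V)]
    (P : Submodule (ZMod 2) V) (s : ℕ)
    [DecidablePred fun W : Submodule (ZMod 2) V => finrank (ZMod 2) (V ⧸ W) = s ∧ P ≤ W] :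
    #{W : Submodule (ZMod 2) V | finrank (ZMod 2) (V ⧸ W) = s ∧ P ≤ W} =
      Nat.card {W : Submodule (ZMod 2) (V ⧸ P) // finrank (ZMod 2) ((V ⧸ P) ⧸ W) = s} := by
  rw [← card_codim_subspaces_ge_eq_card_quotient, Nat.card_eq_fintype_card, Fintype.card_subtype]

variable [FiniteDimensional (ZMod 2) V]

theorem card_filter_mem_submodule [Fintype V] (W : Submodule (ZMod 2) V)
    [DecidablePred fun x : V => x ∈ W] :
    #{x : V | x ∈ W} = 2 ^ finrank (ZMod 2) W := by
  rw [← Fintype.card_subtype, ← Nat.card_eq_fintype_card,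
    natCard_eq_pow_finrank (K := ZMod 2) (V := W), Nat.card_zmod]

open Classical in
/-- The number of subspaces of codimension `s` is a Gaussian binomial coefficient. -/
theorem card_codim_subspaces {n : ℕ} (hV : finrank (ZMod 2) V = n) (s : ℕ) :
    (Nat.card {W : Submodule (ZMod 2) V // finrank (ZMod 2) (V ⧸ W) = s} : ℝ) =
      gaussBinom n s := by
  induction n using Nat.strong_induction_on generalizing V with | _ n ih
  rcases lt_trichotomy n s with hlt | rfl | hgt
  · have : IsEmpty {W : Submodule (ZMod 2) V // finrank (ZMod 2) (V ⧸ W) = s} :=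
      ⟨fun W => by have := W.1.finrank_quotient_add_finrank; omega⟩
    simp [gaussBinom_eq_zero_of_lt hlt]
  · have : Unique {W : Submodule (ZMod 2) V // finrank (ZMod 2) (V ⧸ W) = n} :=
      { default := ⟨⊥, by have := (⊥ : Submodule (ZMod 2) V).finrank_quotient_add_finrank; simp_all⟩
        uniq := fun W => Subtype.ext <| finrank_eq_zero.1 <| by
          have := W.1.finrank_quotient_add_finrank; omega }
    simp [gaussBinom_self]
  obtain ⟨n, rfl⟩ : ∃ m, n = m + 1 := ⟨n - 1, by omega⟩
  have : Finite V := Module.finite_of_finite (ZMod 2)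
  have := Fintype.ofFinite V
  have := Fintype.ofFinite (Submodule (ZMod 2) V)
  have hquot (x : V) (hx : x ≠ 0) :
      (#{W : Submodule (ZMod 2) V | finrank (ZMod 2) (V ⧸ W) = s ∧ span (ZMod 2) {x} ≤ W} : ℝ) =
        gaussBinom n s := by
    rw [card_filter_codim_subspaces_ge]
    refine ih n n.lt_succ_self ?_
    have := (span (ZMod 2) {x}).finrank_quotient_add_finrank
    rw [finrank_span_singleton hx] at this
    omega
  have hpts (W : Submodule (ZMod 2) V) (hW : finrank (ZMod 2) (V ⧸ W) = s) :
      (#{x : V | x ≠ 0 ∧ x ∈ W} : ℝ) = 2 ^ (n + 1 - s) - 1 := by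
    have h1 : ({x : V | x ≠ 0 ∧ x ∈ W} : Finset V) = ({x : V | x ∈ W} : Finset V).erase 0 := by
      ext; simp
    have h2 : finrank (ZMod 2) W = n + 1 - s := by
      have := W.finrank_quotient_add_finrank; omega
    rw [h1, Finset.card_erase_of_mem (by simp), card_filter_mem_submodule, h2,
      Nat.cast_sub Nat.one_le_two_pow]
    simp
  -- Count the pairs `(x, W)` with `0 ≠ x ∈ W` in two ways.
  have hdc := Finset.sum_card_bipartiteAbove_eq_sum_card_bipartiteBelow
    (s := ({x : V | x ≠ 0} : Finset V))
    (t := ({W : Submodule (ZMod 2) V | finrank (ZMod 2) (V ⧸ W) = s} : Finset _))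
    (fun x W => x ∈ W)
  simp only [Finset.bipartiteAbove, Finset.bipartiteBelow, Finset.filter_filter] at hdc
  have hnz : (#{x : V | x ≠ 0} : ℝ) = 2 ^ (n + 1) - 1 := by
    rw [Finset.filter_ne', Finset.card_erase_of_mem (Finset.mem_univ _), Finset.card_univ,
      card_eq_pow_finrank (K := ZMod 2) (V := V), hV, ZMod.card, Nat.cast_sub Nat.one_le_two_pow]
    simp
  have hdc' := congrArg (Nat.cast : ℕ → ℝ) hdc
  push_cast at hdc'
  rw [Finset.sum_congr rfl fun W hW => hpts W (Finset.mem_filter.1 hW).2,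
    Finset.sum_congr rfl fun x hx => by
      simpa only [span_singleton_le_iff_mem] using hquot x (Finset.mem_filter.1 hx).2,
    Finset.sum_const, Finset.sum_const, nsmul_eq_mul, nsmul_eq_mul, hnz] at hdc'
  rw [Nat.card_eq_fintype_card, Fintype.card_subtype]
  have hpos : (2 : ℝ) ^ (n + 1 - s) - 1 ≠ 0 := by
    rw [show n + 1 - s = n - s + 1 by omega]
    exact (two_pow_succ_sub_one_pos _).ne'
  refine mul_right_cancel₀ hpos ?_
  rw [gaussBinom_succ_left_mul, hdc']

open Classical in
theorem card_codim_subspaces_mem_notMem [Fintype (Submodule (ZMod 2) V)] {x y : V} (hx : x ≠ 0)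
    (hy : y ≠ 0) (hxy : y ≠ x) (s : ℕ) :
    (#{W : Submodule (ZMod 2) V | finrank (ZMod 2) (V ⧸ W) = s ∧ x ∈ W ∧ y ∉ W} : ℝ) =
      gaussBinom (finrank (ZMod 2) V - 1) s - gaussBinom (finrank (ZMod 2) V - 2) s := by
  have hge (P : Submodule (ZMod 2) V) :
      (#{W : Submodule (ZMod 2) V | finrank (ZMod 2) (V ⧸ W) = s ∧ P ≤ W} : ℝ) =
        gaussBinom (finrank (ZMod 2) V - finrank (ZMod 2) P) s := by
    rw [card_filter_codim_subspaces_ge]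
    exact card_codim_subspaces (by have := P.finrank_quotient_add_finrank; omega) s
  have h1 := hge (span (ZMod 2) {x})
  have h2 := hge (span (ZMod 2) {x, y})
  have hli : LinearIndependent (ZMod 2) ![x, y] := by
    rw [LinearIndependent.pair_iff' hx]
    intro a
    fin_cases a
    · exact (zero_smul (ZMod 2) x).trans_ne hy.symm
    · exact (one_smul (ZMod 2) x).trans_ne hxy.symm
  have hfin : finrank (ZMod 2) (span (ZMod 2) {x, y}) = 2 := by
    rw [← Matrix.range_cons_cons_empty x y ![], finrank_span_eq_card hli, Fintype.card_fin]
  rw [finrank_span_singleton hx] at h1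
  rw [hfin] at h2
  simp only [span_le, Set.singleton_subset_iff, Set.insert_subset_iff, SetLike.mem_coe] at h1 h2
  rw [← h1, ← h2, eq_sub_iff_add_eq, ← Nat.cast_add,
    ← Finset.card_filter_add_card_filter_not (p := fun W : Submodule (ZMod 2) V => y ∉ W)
      (s := {W : Submodule (ZMod 2) V | finrank (ZMod 2) (V ⧸ W) = s ∧ x ∈ W})]
  simp only [Finset.filter_filter, not_not, and_assoc]

open Classical in
/-- The points of `W` that `α` moves out of `W` all lie outside the fixed space of `α`, whose
trace on `W` has codimension in `W` at most its codimension in `V`. -/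
theorem card_mem_map_notMem_mul_le [Fintype V] (f : V →ₗ[ZMod 2] V) (W : Submodule (ZMod 2) V) :
    (#{x : V | x ∈ W ∧ f x ∉ W} : ℝ) * 2 ^ finrank (ZMod 2) (V ⧸ W) ≤ #{x : V | f x ≠ x} := by
  set K := LinearMap.ker (f - LinearMap.id)
  have hK (x : V) : x ∈ K ↔ f x = x := by simp [K, sub_eq_zero]
  have hW := W.finrank_quotient_add_finrank
  have hinf := finrank_sup_add_finrank_inf_eq W K
  have hsup := finrank_le (W ⊔ K)
  have h1 : #{x : V | x ∈ W ∧ f x ∉ W} + 2 ^ finrank (ZMod 2) ↥(W ⊓ K) ≤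
      2 ^ finrank (ZMod 2) W := by
    rw [← card_filter_mem_submodule, ← card_filter_mem_submodule, ← Finset.card_union_of_disjoint]
    · refine Finset.card_le_card fun x hx => ?_
      simp only [Finset.mem_union, Finset.mem_filter, Finset.mem_univ, true_and, Submodule.mem_inf] at hx ⊢
      tauto
    · refine Finset.disjoint_filter.2 fun x _ hx hxK => hx.2 ?_
      rw [(hK x).1 hxK.2]
      exact hx.1
  have h2 : 2 ^ finrank (ZMod 2) K + #{x : V | f x ≠ x} = 2 ^ finrank (ZMod 2) V := by
    rw [← card_filter_mem_submodule]
    simp only [hK, ne_eq]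
    rw [Finset.card_filter_add_card_filter_not, Finset.card_univ,
      card_eq_pow_finrank (K := ZMod 2) (V := V), ZMod.card]
  have h3 : 2 ^ finrank (ZMod 2) K ≤
      2 ^ finrank (ZMod 2) ↥(W ⊓ K) * 2 ^ finrank (ZMod 2) (V ⧸ W) := by
    rw [← pow_add]
    exact Nat.pow_le_pow_right two_pos (by omega)
  have h4 := Nat.mul_le_mul_right (2 ^ finrank (ZMod 2) (V ⧸ W)) h1
  rw [add_mul, ← pow_add 2 (finrank (ZMod 2) W), add_comm (finrank (ZMod 2) W), hW] at h4
  have h5 : #{x : V | x ∈ W ∧ f x ∉ W} * 2 ^ finrank (ZMod 2) (V ⧸ W) ≤ #{x : V | f x ≠ x} := by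
    omega
  exact_mod_cast h5

open Classical in
/-- Double counting of the pairs `(x, W)` with `x ∈ W` and `α x ∉ W`. -/
theorem le_card_codim_subspaces_map_ne [Fintype (Submodule (ZMod 2) V)]
    (α : V ≃ₗ[ZMod 2] V) (hα : α ≠ 1) (s : ℕ) :
    2 ^ s * (gaussBinom (finrank (ZMod 2) V - 1) s - gaussBinom (finrank (ZMod 2) V - 2) s) ≤
      (#{W : Submodule (ZMod 2) V |
        finrank (ZMod 2) (V ⧸ W) = s ∧ W.map (α : V →ₗ[ZMod 2] V) ≠ W} : ℝ) := by
  have : Finite V := Module.finite_of_finite (ZMod 2)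
  have := Fintype.ofFinite V
  set M : Finset V := {x : V | α x ≠ x}
  have hM : (0 : ℝ) < #M := by
    obtain ⟨x, hx⟩ : ∃ x, α x ≠ x := by
      by_contra! h
      exact hα (LinearEquiv.ext h)
    exact_mod_cast Finset.card_pos.2 ⟨x, by simpa [M] using hx⟩
  set N : Finset (Submodule (ZMod 2) V) := {W : Submodule (ZMod 2) V |
    finrank (ZMod 2) (V ⧸ W) = s ∧ W.map (α : V →ₗ[ZMod 2] V) ≠ W}
  have hdc := Finset.sum_card_bipartiteAbove_eq_sum_card_bipartiteBelow
    (s := M) (t := N) (fun x W => x ∈ W ∧ α x ∉ W)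
  have hdc' := congrArg (Nat.cast : ℕ → ℝ) hdc
  push_cast at hdc'
  have hx : ∀ x ∈ M, (#(N.bipartiteAbove (fun x W => x ∈ W ∧ α x ∉ W) x) : ℝ) =
      gaussBinom (finrank (ZMod 2) V - 1) s - gaussBinom (finrank (ZMod 2) V - 2) s := by
    intro x hx
    have hne : α x ≠ x := by simpa [M] using hx
    have hx0 : x ≠ 0 := by rintro rfl; simp at hne
    rw [← card_codim_subspaces_mem_notMem hx0 (by simpa using hx0) hne s]
    congr 2
    ext W
    simp only [Finset.bipartiteAbove, N, Finset.filter_filter, Finset.mem_filter, Finset.mem_univ,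
      true_and, and_assoc]
    refine and_congr_right fun _ => and_iff_right_of_imp fun h hW => h.2 ?_
    rw [← hW]
    exact mem_map_of_mem h.1
  have hW : ∀ W ∈ N, (#(M.bipartiteBelow (fun x W => x ∈ W ∧ α x ∉ W) W) : ℝ) * 2 ^ s ≤ #M := by
    intro W hW
    have h := card_mem_map_notMem_mul_le (α : V →ₗ[ZMod 2] V) W
    rw [(Finset.mem_filter.1 hW).2.1] at h
    refine le_trans ?_ h
    gcongr
    exact Finset.filter_subset_filter _ (Finset.subset_univ M)
  rw [Finset.sum_congr rfl hx, Finset.sum_const, nsmul_eq_mul] at hdc'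
  have hsum := Finset.sum_le_sum hW
  rw [← Finset.sum_mul, ← hdc', Finset.sum_const, nsmul_eq_mul] at hsum
  refine le_of_mul_le_mul_left ?_ hM
  linarith

end SubspaceCount

/-- If `V` is an `r`-dimensional vector space over `F₂` and `α ∈ GL(V)`, `α ≠ 1`, then the
number of `α`-invariant subspaces of codimension `s` is at most
`C(r−1, s−1)₂ + C(r−2, s)₂·2^s`. -/
theorem card_fixed_subspaces_upper_bound
    (r s : ℕ) (hs : 0 < s) (hrs : s < r)
    (V : Type*) [AddCommGroup V] [Module (ZMod 2) V] [FiniteDimensional (ZMod 2) V]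
    (hV : Module.finrank (ZMod 2) V = r)
    (α : V ≃ₗ[ZMod 2] V) (hα : α ≠ 1) :
    (Nat.card {W : Submodule (ZMod 2) V //
        Module.finrank (ZMod 2) (V ⧸ W) = s ∧
        Submodule.map (α : V →ₗ[ZMod 2] V) W = W} : ℝ) ≤
      gaussBinom (r - 1) (s - 1) + gaussBinom (r - 2) s * (2 : ℝ) ^ s := by
  classical
  subst hV
  have : Finite V := Module.finite_of_finite (ZMod 2)
  have := Fintype.ofFinite (Submodule (ZMod 2) V)
  have htotal := card_codim_subspaces (V := V) rfl s
  have hmoved := le_card_codim_subspaces_map_ne α hα s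
  rw [Nat.card_eq_fintype_card, Fintype.card_subtype, ← Finset.card_filter_add_card_filter_not
    (p := fun W : Submodule (ZMod 2) V => W.map (α : V →ₗ[ZMod 2] V) = W),
    Finset.filter_filter, Finset.filter_filter, Nat.cast_add] at htotal
  rw [Nat.card_eq_fintype_card, Fintype.card_subtype]
  have hpascal := gaussBinom_succ_succ (n := Module.finrank (ZMod 2) V - 1) (s := s - 1) (by omega)
  rw [Nat.sub_add_cancel (by omega), Nat.sub_add_cancel (by omega)] at hpascal
  linarith
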